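/- Let Ω = ℝ^d_+ be the half-space and T > 0. Suppose u satisfies ∫₀^T ∫_Ω u (∂_t φ + Δφ) dx dt = 0 for every test function φ ∈ C([0,T]; W^{1,1}₀(Ω) ∩ W^{2,1}(Ω) ∩ C(Ω)) ∩ C¹([0,T]; L¹(Ω)) with |∇φ(x)| ≤ C(1 + |x|²)^{−d/2}. Then u = 0 almost everywhere in (0,T) × Ω. -/

import Mathlib

open MeasureTheory Filter Topology
open scoped ENNReal NNReal

noncomputable section

/-- Euclidean space `ℝ^d`. -/
abbrev Euc (d : ℕ) := EuclideanSpace ℝ (Fin d)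

variable {d : ℕ}

/-- `φ` is a test function on `Ω`, i.e. `φ ∈ C_c^∞(Ω)`. -/
def IsTestFun (Ω : Set (Euc d)) (φ : Euc d → ℝ) : Prop :=
  ContDiff ℝ (⊤ : ℕ∞) φ ∧ HasCompactSupport φ ∧ tsupport φ ⊆ Ω

/-- Classical partial derivative in the `i`-th coordinate direction. -/
def pd (i : Fin d) (f : Euc d → ℝ) (x : Euc d) : ℝ :=
  fderiv ℝ f x (EuclideanSpace.single i 1)

/-- Classical Laplacian. -/
def lap (f : Euc d → ℝ) (x : Euc d) : ℝ := ∑ i, pd i (pd i f) x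

/-- Iterated classical partial derivatives along a multi-index. -/
def iterPD : {m : ℕ} → (Fin m → Fin d) → (Euc d → ℝ) → Euc d → ℝ
  | 0, _, f => f
  | _ + 1, a, f => iterPD (fun i => a i.succ) (pd (a 0) f)

/-- `v` is the family of `m`-th order weak partial derivatives of `u` on `Ω`. -/
def HasWeakDerivs (Ω : Set (Euc d)) (m : ℕ) (u : Euc d → ℝ)
    (v : (Fin m → Fin d) → Euc d → ℝ) : Prop :=
  ∀ a : Fin m → Fin d, ∀ φ : Euc d → ℝ, IsTestFun Ω φ →
    ∫ x in Ω, u x * iterPD a φ x = (-1 : ℝ) ^ m * ∫ x in Ω, v a x * φ x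

/-- Membership in the Sobolev space `W^{k,p}(Ω)`. -/
def MemW (Ω : Set (Euc d)) (p : ℝ≥0∞) (k : ℕ) (u : Euc d → ℝ) : Prop :=
  ∀ m : ℕ, m ≤ k → ∃ v, HasWeakDerivs Ω m u v ∧
    ∀ a, MemLp (v a) p (volume.restrict Ω)

/-- Pointwise magnitude of a family of `m`-th order derivatives. -/
def Dmag {m : ℕ} (v : (Fin m → Fin d) → Euc d → ℝ) (x : Euc d) : ℝ :=
  ∑ a : Fin m → Fin d, |v a x|

/-- `L^p(Ω)` norm of a family of `m`-th order derivatives. -/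
def DkNorm (Ω : Set (Euc d)) (p : ℝ≥0∞) {m : ℕ}
    (v : (Fin m → Fin d) → Euc d → ℝ) : ℝ≥0∞ :=
  eLpNorm (Dmag v) p (volume.restrict Ω)

/-- Membership in `W^{1,p}_0(Ω)`: there is a weak gradient, and `u` is approximated
together with its gradient by test functions in the `L^p` norm. -/
def MemW10 (Ω : Set (Euc d)) (p : ℝ≥0∞) (u : Euc d → ℝ) : Prop :=
  ∃ v : Fin d → Euc d → ℝ,
    HasWeakDerivs Ω 1 u (fun a => v (a 0)) ∧
    (∀ i, MemLp (v i) p (volume.restrict Ω)) ∧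
    ∃ φ : ℕ → Euc d → ℝ, (∀ n, IsTestFun Ω (φ n)) ∧
      Tendsto (fun n =>
        eLpNorm (fun x => u x - φ n x) p (volume.restrict Ω) +
        ∑ i : Fin d, eLpNorm (fun x => v i x - pd i (φ n) x) p (volume.restrict Ω))
        atTop (𝓝 0)

/-- `Δu = f` holds weakly (in the distributional sense) in `Ω`. -/
def IsWeakLap (Ω : Set (Euc d)) (u f : Euc d → ℝ) : Prop :=
  ∀ φ : Euc d → ℝ, IsTestFun Ω φ →
    ∫ x in Ω, u x * lap φ x = ∫ x in Ω, f x * φ x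

/-- `Ω` is a bounded domain. -/
def IsBoundedDomain (Ω : Set (Euc d)) : Prop :=
  IsOpen Ω ∧ IsConnected Ω ∧ Bornology.IsBounded Ω

/-- `Ω` has a `C^k` boundary, described by local level sets of `C^k` defining
functions with nonvanishing gradient. -/
def HasCkBoundary (Ω : Set (Euc d)) (k : ℕ∞) : Prop :=
  ∀ x ∈ frontier Ω, ∃ (U : Set (Euc d)) (ρ : Euc d → ℝ),
    IsOpen U ∧ x ∈ U ∧ ContDiffOn ℝ k ρ U ∧
    (∀ y ∈ U, fderiv ℝ ρ y ≠ 0) ∧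
    Ω ∩ U = {y ∈ U | ρ y < 0} ∧ frontier Ω ∩ U = {y ∈ U | ρ y = 0}

/-- `L^p(Ω)` norm of the (classical) `m`-th order derivatives of `f`. -/
def cDNorm (Ω : Set (Euc d)) (p : ℝ≥0∞) (m : ℕ) (f : Euc d → ℝ) : ℝ≥0∞ :=
  eLpNorm (fun x => ‖iteratedFDeriv ℝ m f x‖) p (volume.restrict Ω)

/-- `u` is the solution of the heat equation on `Ω` with Dirichlet boundary
condition and initial data `u₀`: it is continuous up to the parabolic boundary,
smooth in space for positive times, satisfies `∂ₜ u = Δu` in `Ω`, vanishes on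
`∂Ω`, and starts from `u₀`. -/
def IsHeatSol (Ω : Set (Euc d)) (u₀ : Euc d → ℝ) (u : ℝ → Euc d → ℝ) : Prop :=
  ContinuousOn (fun q : ℝ × Euc d => u q.1 q.2) (Set.Ici 0 ×ˢ closure Ω) ∧
  (∀ t, 0 < t → ContDiffOn ℝ (⊤ : ℕ∞) (u t) Ω) ∧
  (∀ t, 0 < t → ∀ x ∈ Ω, HasDerivAt (fun s => u s x) (lap (u t) x) t) ∧
  (∀ t, 0 < t → ∀ x ∈ frontier Ω, u t x = 0) ∧
  (∀ x, u 0 x = u₀ x)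

/-- The quantity `N[u](t,x) = |u| + t^{1/2}|∇u| + t|∇²u| + t|∂ₜ u|`. -/
def Nfun (u : ℝ → Euc d → ℝ) (t : ℝ) (x : Euc d) : ℝ :=
  |u t x| + Real.sqrt t * ‖fderiv ℝ (u t) x‖ + t * ‖iteratedFDeriv ℝ 2 (u t) x‖ +
    t * |deriv (fun s => u s x) t|

/-- The upper half space `ℝ^{d+1}_+`. -/
def halfSpace (d : ℕ) : Set (Euc (d+1)) := {x | 0 < x (Fin.last d)}

/-- The cube of side length `t^{1/2}` centered at `t^{1/2} n`, `n ∈ ℤ^d`. -/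
def cube (t : ℝ) (n : Fin d → ℤ) : Set (Euc d) :=
  {x | ∀ i, |x i - Real.sqrt t * (n i : ℝ)| ≤ Real.sqrt t / 2}

end

section HalfSpaceAux

open Set

lemma IsTestFun.pd_test {n : ℕ} {Ω : Set (Euc n)} {φ : Euc n → ℝ} (h : IsTestFun Ω φ) (i : Fin n) :
    IsTestFun Ω (pd i φ) := by
  obtain ⟨h1, h2, h3⟩ := h
  refine ⟨?_, ?_, ?_⟩
  · have : ContDiff ℝ (⊤ : ℕ∞) (fderiv ℝ φ) := h1.fderiv_right (by simp)
    exact this.clm_apply contDiff_const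
  · exact h2.fderiv_apply (𝕜 := ℝ) _
  · exact (tsupport_fderiv_apply_subset ℝ _).trans h3

lemma pd_contDiff {n : ℕ} {f : Euc n → ℝ} (h1 : ContDiff ℝ (⊤ : ℕ∞) f) (i : Fin n) :
    ContDiff ℝ (⊤ : ℕ∞) (pd i f) := by
  have : ContDiff ℝ (⊤ : ℕ∞) (fderiv ℝ f) := h1.fderiv_right (by simp)
  exact this.clm_apply contDiff_const

lemma IsTestFun.setInt {n : ℕ} {Ω : Set (Euc n)} {φ : Euc n → ℝ} (h : IsTestFun Ω φ)
    (f : Euc n → ℝ) : ∫ x in Ω, f x * φ x = ∫ x, f x * φ x := by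
  apply setIntegral_eq_integral_of_forall_compl_eq_zero
  intro x hx
  have : x ∉ tsupport φ := fun hh => hx (h.2.2 hh)
  rw [image_eq_zero_of_notMem_tsupport this, mul_zero]

lemma weak_ibp {n : ℕ} {Ω : Set (Euc n)} {φ : Euc n → ℝ} (h : IsTestFun Ω φ)
    {f : Euc n → ℝ} (hf : ContDiff ℝ (⊤ : ℕ∞) f) (i : Fin n) :
    ∫ x in Ω, f x * pd i φ x = - ∫ x in Ω, pd i f x * φ x := by
  rw [h.setInt, (h.pd_test i).setInt]
  have hp := h.pd_test i
  apply integral_mul_fderiv_eq_neg_fderiv_mul_of_integrable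
  · exact ((pd_contDiff hf i).continuous.mul h.1.continuous).integrable_of_hasCompactSupport
      (h.2.1.mul_left)
  · exact (hf.continuous.mul hp.1.continuous).integrable_of_hasCompactSupport
      (hp.2.1.mul_left)
  · exact (hf.continuous.mul h.1.continuous).integrable_of_hasCompactSupport
      (h.2.1.mul_left)
  · intro x _; exact (hf.differentiable (by simp)) x
  · intro x _; exact (h.1.differentiable (by simp)) x

lemma memW_of_smooth {n : ℕ} (Ω : Set (Euc n)) {f : Euc n → ℝ} (hf : ContDiff ℝ (⊤ : ℕ∞) f)
    (h0 : Integrable f) (h1 : ∀ i, Integrable (pd i f)) (h2 : ∀ i j, Integrable (pd i (pd j f))) :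
    MemW Ω 1 2 f := by
  intro m hm
  interval_cases m
  · refine ⟨fun _ => f, ?_, fun _ => memLp_one_iff_integrable.2 h0.restrict⟩
    intro a φ hφ
    simp [iterPD]
  · refine ⟨fun a => pd (a 0) f, ?_, fun _ => memLp_one_iff_integrable.2 (h1 _).restrict⟩
    intro a φ hφ
    simp only [iterPD]
    rw [weak_ibp hφ hf]; simp
  · refine ⟨fun a => pd (a 0) (pd (a 1) f), ?_, fun _ => memLp_one_iff_integrable.2 (h2 _ _).restrict⟩
    intro a φ hφ
    simp only [iterPD]
    rw [weak_ibp (hφ.pd_test _) hf, weak_ibp hφ (pd_contDiff hf _)]; simp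

/-- one-sided smooth truncation -/
noncomputable def trunc (k : ℝ) (r : ℝ) : ℝ := r * Real.smoothTransition (k * r - 1)

lemma trunc_smooth (k : ℝ) : ContDiff ℝ (⊤ : ℕ∞) (trunc k) := by
  unfold trunc
  exact contDiff_id.mul (Real.smoothTransition.contDiff.comp (by fun_prop))

lemma trunc_zero {k r : ℝ} (h : k * r ≤ 1) : trunc k r = 0 := by
  unfold trunc
  rw [Real.smoothTransition.zero_of_nonpos (by linarith), mul_zero]

lemma trunc_abs (k r : ℝ) : |r - trunc k r| ≤ |r| := by
  unfold trunc
  have h1 := Real.smoothTransition.nonneg (k * r - 1)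
  have h2 := Real.smoothTransition.le_one (k * r - 1)
  rw [show r - r * Real.smoothTransition (k * r - 1) = r * (1 - Real.smoothTransition (k * r - 1)) by ring,
    abs_mul]
  apply mul_le_of_le_one_right (abs_nonneg _)
  rw [abs_le]; constructor <;> linarith

lemma trunc_eq {k r : ℝ} (h : 2 ≤ k * r) : trunc k r = r := by
  unfold trunc
  rw [Real.smoothTransition.one_of_one_le (by linarith), mul_one]

lemma deriv_trunc_eq {k r : ℝ} (h : 2 < k * r) : deriv (trunc k) r = 1 := by
  have : trunc k =ᶠ[𝓝 r] id := by
    have : ∀ᶠ x in 𝓝 r, 2 < k * x :=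
      (continuous_const.mul continuous_id).continuousAt.eventually (lt_mem_nhds h)
    filter_upwards [this] with x hx using trunc_eq hx.le
  rw [this.deriv_eq]; simp

lemma deriv_smoothTransition_bound : ∃ C : ℝ, 0 ≤ C ∧
    ∀ x, |deriv Real.smoothTransition x| ≤ C ∧ |deriv Real.smoothTransition x * x| ≤ C := by
  have hz1 : ∀ x, x < 0 → deriv Real.smoothTransition x = 0 := by
    intro x hx
    have : Real.smoothTransition =ᶠ[𝓝 x] fun _ => (0:ℝ) := by
      filter_upwards [gt_mem_nhds hx] with y hy using Real.smoothTransition.zero_of_nonpos hy.le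
    rw [this.deriv_eq]; simp
  have hz2 : ∀ x, 1 < x → deriv Real.smoothTransition x = 0 := by
    intro x hx
    have : Real.smoothTransition =ᶠ[𝓝 x] fun _ => (1:ℝ) := by
      filter_upwards [lt_mem_nhds hx] with y hy using Real.smoothTransition.one_of_one_le hy.le
    rw [this.deriv_eq]; simp
  have hc : Continuous (deriv Real.smoothTransition) :=
    (Real.smoothTransition.contDiff (n := 1)).continuous_deriv (by simp)
  obtain ⟨C, hC⟩ := (isCompact_Icc (a := (0:ℝ)) (b := 1)).exists_bound_of_continuousOn hc.continuousOn
  have hC0 : 0 ≤ C := (norm_nonneg _).trans (hC 0 (by simp))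
  refine ⟨C, hC0, fun x => ?_⟩
  by_cases hx : x ∈ Icc (0:ℝ) 1
  · have := hC x hx
    rw [Real.norm_eq_abs] at this
    refine ⟨this, ?_⟩
    rw [abs_mul]
    have h2 : |x| ≤ 1 := by rw [abs_le]; constructor <;> linarith [hx.1, hx.2]
    nlinarith [abs_nonneg x, abs_nonneg (deriv Real.smoothTransition x)]
  · have : deriv Real.smoothTransition x = 0 := by
      by_cases h0 : x < 0
      · exact hz1 x h0
      · exact hz2 x (by by_contra h1; exact hx ⟨by linarith, by linarith⟩)
    simp [this, hC0]

lemma deriv_trunc_bound : ∃ C : ℝ, ∀ k r, |1 - deriv (trunc k) r| ≤ C := by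
  obtain ⟨C, hC0, hC⟩ := deriv_smoothTransition_bound
  refine ⟨1 + 2 * C, fun k r => ?_⟩
  have hd : HasDerivAt (trunc k) (1 * Real.smoothTransition (k * r - 1) +
      r * (deriv Real.smoothTransition (k * r - 1) * k)) r := by
    apply (hasDerivAt_id r).mul
    have h1 : HasDerivAt Real.smoothTransition (deriv Real.smoothTransition (k * r - 1)) (k * r - 1) :=
      ((Real.smoothTransition.contDiff (n := 1)).differentiable (by simp) _).hasDerivAt
    have h2 : HasDerivAt (fun r => k * r - 1) k r := by
      simpa using ((hasDerivAt_id r).const_mul k).sub_const 1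
    exact h1.comp r h2
  rw [hd.deriv]
  obtain ⟨h1, h2⟩ := hC (k * r - 1)
  have h3 := Real.smoothTransition.nonneg (k * r - 1)
  have h4 := Real.smoothTransition.le_one (k * r - 1)
  rw [abs_le] at *
  have : r * (deriv Real.smoothTransition (k * r - 1) * k) =
    deriv Real.smoothTransition (k * r - 1) * (k * r - 1) + deriv Real.smoothTransition (k * r - 1) := by ring
  rw [this]
  constructor <;> linarith [h1.1, h1.2, h2.1, h2.2]

lemma memW10_of_smooth {n : ℕ} {Ω : Set (Euc n)} (hΩ : MeasurableSet Ω)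
    {f : Euc n → ℝ} (hf : ContDiff ℝ (⊤ : ℕ∞) f)
    (h0 : Integrable f) (h1 : ∀ i, Integrable (pd i f))
    (hpos : ∀ x ∈ Ω, 0 < f x) (hneg : ∀ x ∉ Ω, f x ≤ 0)
    (hlim : Tendsto f (cocompact (Euc n)) (𝓝 0)) : MemW10 Ω 1 f := by
  obtain ⟨C, hC⟩ := deriv_trunc_bound
  have hpd : ∀ (k : ℝ) i x, pd i (fun x => trunc k (f x)) x = deriv (trunc k) (f x) * pd i f x := by
    intro k i x
    have hh : HasFDerivAt (fun x => trunc k (f x)) (deriv (trunc k) (f x) • fderiv ℝ f x) x :=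
      HasDerivAt.comp_hasFDerivAt x
        (((trunc_smooth k).differentiable (by simp) _).hasDerivAt)
        ((hf.differentiable (by simp) x).hasFDerivAt)
    simp [pd, hh.fderiv]
  refine ⟨fun i => pd i f, ?_, fun i => memLp_one_iff_integrable.2 (h1 _).restrict,
    fun k x => trunc (k + 1) (f x), ?_, ?_⟩
  · intro a φ hφ
    simp only [iterPD]
    rw [weak_ibp hφ hf]; simp
  · intro k
    have hk : (0:ℝ) < k + 1 := by positivity
    have hsub : tsupport (fun x => trunc (k + 1) (f x)) ⊆ {x | 1 ≤ (k + 1) * f x} := by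
      apply closure_minimal
      · intro x hx
        by_contra hh
        simp only [mem_ofPred_eq, not_le] at hh
        exact hx (trunc_zero hh.le)
      · exact isClosed_le continuous_const (continuous_const.mul hf.continuous)
    refine ⟨(trunc_smooth _).comp hf, ?_, ?_⟩
    · have : ∀ᶠ x in cocompact (Euc n), f x < 1 / (k + 1) :=
        hlim.eventually (gt_mem_nhds (by positivity))
      rw [Filter.eventually_iff, mem_cocompact] at this
      obtain ⟨s, hs, hs2⟩ := this
      apply HasCompactSupport.intro hs
      intro x hx
      have := hs2 hx
      simp only [mem_ofPred_eq] at this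
      apply trunc_zero
      rw [lt_div_iff₀ hk] at this
      linarith
    · intro x hx
      have := hsub hx
      simp only [mem_ofPred_eq] at this
      by_contra hh
      nlinarith [hneg x hh]
  · have key : ∀ x ∈ Ω, ∀ᶠ k : ℕ in atTop, 2 < ((k:ℝ) + 1) * f x := by
      intro x hx
      have h3 := hpos x hx
      obtain ⟨N, hN⟩ := exists_nat_gt (2 / f x)
      filter_upwards [eventually_ge_atTop N] with k hk
      have : (N:ℝ) ≤ k := by exact_mod_cast hk
      rw [div_lt_iff₀ h3] at hN
      nlinarith
    have z : (0 : ℝ≥0∞) = 0 + ∑ i : Fin n, 0 := by simp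
    rw [z]
    refine Tendsto.add ?_ (tendsto_finsetSum _ fun i _ => ?_)
    · simp_rw [eLpNorm_one_eq_lintegral_enorm]
      have := tendsto_lintegral_of_dominated_convergence' (μ := volume.restrict Ω)
        (F := fun (k:ℕ) x => ‖f x - trunc (k + 1) (f x)‖ₑ) (f := fun _ => 0) (fun x => ‖f x‖ₑ)
        (fun k => ((hf.continuous.sub ((trunc_smooth _).continuous.comp hf.continuous)).enorm.measurable.aemeasurable))
        (fun k => ?_) ?_ ?_
      · simpa using this
      · filter_upwards with x
        rw [enorm_le_iff_norm_le]
        exact trunc_abs _ _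
      · have := h0.restrict (s := Ω).2
        exact this.ne
      · filter_upwards [ae_restrict_mem hΩ] with x hx
        apply tendsto_const_nhds.congr'
        filter_upwards [key x hx] with k hk
        rw [trunc_eq hk.le]; simp
    · simp_rw [eLpNorm_one_eq_lintegral_enorm]
      have := tendsto_lintegral_of_dominated_convergence' (μ := volume.restrict Ω)
        (F := fun (k:ℕ) x => ‖pd i f x - pd i (fun x => trunc (k + 1) (f x)) x‖ₑ) (f := fun _ => 0)
        (fun x => ‖C * pd i f x‖ₑ)
        (fun k => (((pd_contDiff hf i).continuous.sub (pd_contDiff ((trunc_smooth _).comp hf) i).continuous).enorm.measurable.aemeasurable))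
        (fun k => ?_) ?_ ?_
      · simpa using this
      · filter_upwards with x
        rw [enorm_le_iff_norm_le, hpd, ← one_sub_mul, norm_mul, norm_mul]
        gcongr
        rw [Real.norm_eq_abs, Real.norm_eq_abs]
        exact (hC _ _).trans (le_abs_self _)
      · have := ((h1 i).const_mul C).restrict (s := Ω).2
        exact this.ne
      · filter_upwards [ae_restrict_mem hΩ] with x hx
        apply tendsto_const_nhds.congr'
        filter_upwards [key x hx] with k hk
        rw [hpd, deriv_trunc_eq hk]; simp

/-- Gaussian -/
noncomputable def gs {n : ℕ} (b : ℝ) (y x : Euc n) : ℝ := Real.exp (-b * ‖x - y‖ ^ 2)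

lemma gs_pos {n : ℕ} (b : ℝ) (y x : Euc n) : 0 < gs b y x := Real.exp_pos _

lemma gs_smooth {n : ℕ} (b : ℝ) (y : Euc n) : ContDiff ℝ (⊤ : ℕ∞) (gs b y) := by
  unfold gs
  exact Real.contDiff_exp.comp (contDiff_const.mul ((contDiff_id.sub contDiff_const).norm_sq ℝ))

lemma gs_hasFDerivAt {n : ℕ} (b : ℝ) (y x : Euc n) :
    HasFDerivAt (gs b y) ((-2 * b * gs b y x) • innerSL ℝ (x - y)) x := by
  have h1 : HasFDerivAt (fun x : Euc n => ‖x - y‖ ^ 2) (2 • (innerSL ℝ (x - y))) x := by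
    have := ((hasFDerivAt_id (𝕜 := ℝ) x).sub_const y).norm_sq
    exact this
  have h2 := (h1.const_mul (-b)).exp
  have e : (-2 * b * gs b y x) • innerSL ℝ (x - y) =
      Real.exp (-b * ‖x - y‖ ^ 2) • (-b) • 2 • (innerSL ℝ (x - y)) := by
    ext v
    simp [gs]; ring
  rw [e]
  exact h2

lemma pd_gs {n : ℕ} (b : ℝ) (y : Euc n) (i : Fin n) (x : Euc n) :
    pd i (gs b y) x = -2 * b * (x i - y i) * gs b y x := by
  rw [pd, (gs_hasFDerivAt b y x).fderiv]
  simp [EuclideanSpace.inner_single_right]; ring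

lemma pd_pd_gs {n : ℕ} (b : ℝ) (y : Euc n) (i j : Fin n) (x : Euc n) :
    pd j (pd i (gs b y)) x = (4 * b ^ 2 * (x i - y i) * (x j - y j) -
      2 * b * (if i = j then 1 else 0)) * gs b y x := by
  have : pd i (gs b y) = fun x => -2 * b * (x i - y i) * gs b y x := funext (pd_gs b y i)
  rw [this]
  have h1 : HasFDerivAt (fun x : Euc n => -2 * b * (x i - y i))
      ((-2 * b) • (EuclideanSpace.proj i : Euc n →L[ℝ] ℝ)) x := by
    exact (((EuclideanSpace.proj i : Euc n →L[ℝ] ℝ).hasFDerivAt).sub_const (y i)).const_mul (-2 * b)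
  have h2 := h1.fun_mul (gs_hasFDerivAt b y x)
  rw [pd, h2.fderiv]
  simp [EuclideanSpace.inner_single_right]
  split_ifs <;> ring

lemma lap_gs {n : ℕ} (b : ℝ) (y : Euc n) (x : Euc n) :
    lap (gs b y) x = (4 * b ^ 2 * ‖x - y‖ ^ 2 - 2 * b * n) * gs b y x := by
  unfold lap
  simp_rw [pd_pd_gs]
  rw [← Finset.sum_mul, EuclideanSpace.norm_sq_eq]
  congr 1
  simp [Finset.sum_sub_distrib, Finset.mul_sum]
  rw [mul_comm (n : ℝ)]
  congr 1
  exact Finset.sum_congr rfl fun i _ => by ring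

lemma mul_exp_bound {c : ℝ} (hc : 0 < c) (N : ℕ) : ∃ C : ℝ, 0 ≤ C ∧ ∀ r : ℝ, 0 ≤ r →
    (1 + r) ^ N * Real.exp (-c * r) ≤ C := by
  refine ⟨N.factorial / c ^ N * Real.exp c, by positivity, fun r hr => ?_⟩
  have h := Real.pow_div_factorial_le_exp (c * (1 + r)) (by positivity) N
  rw [mul_pow, div_le_iff₀ (by positivity)] at h
  have e : Real.exp (c * (1 + r)) = Real.exp c * Real.exp (c * r) := by
    rw [← Real.exp_add]; ring_nf
  rw [neg_mul, Real.exp_neg, ← div_eq_mul_inv, div_le_iff₀ (Real.exp_pos _)]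
  rw [e] at h
  have : (1 + r) ^ N ≤ Real.exp c * Real.exp (c * r) * N.factorial / c ^ N := by
    rw [le_div_iff₀ (by positivity)]; linarith
  calc _ ≤ _ := this
    _ = _ := by ring

lemma gs_split {n : ℕ} (b : ℝ) (y x : Euc n) : gs b y x = gs (b/2) y x * gs (b/2) y x := by
  unfold gs; rw [← Real.exp_add]; ring_nf

/-- polynomial times Gaussian is bounded by a wider Gaussian -/
lemma gs_poly_bound {n : ℕ} {b : ℝ} (hb : 0 < b) (N : ℕ) : ∃ C : ℝ, 0 ≤ C ∧ ∀ y x : Euc n,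
    (1 + ‖x - y‖ ^ 2) ^ N * gs b y x ≤ C * gs (b / 2) y x := by
  obtain ⟨C, hC0, hC⟩ := mul_exp_bound (half_pos hb) N
  refine ⟨C, hC0, fun y x => ?_⟩
  rw [gs_split, ← mul_assoc]
  gcongr
  · exact (gs_pos _ _ _).le
  · exact hC _ (by positivity)

lemma gs_integrable {n : ℕ} {b : ℝ} (hb : 0 < b) (y : Euc n) : Integrable (gs b y) := by
  have h := (GaussianFourier.integrable_cexp_neg_mul_sq_norm_add (V := Euc n) (b := (b:ℂ))
    (by simpa using hb) 0 0).norm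
  have h2 : Integrable (fun x : Euc n => Real.exp (-b * ‖x‖ ^ 2)) := by
    refine h.congr (ae_of_all _ fun x => ?_)
    simp [Complex.norm_exp, ← Complex.ofReal_pow]
  exact h2.comp_sub_right y

lemma gs_integral {n : ℕ} {b : ℝ} (hb : 0 < b) (y : Euc n) :
    ∫ x, gs b y x = (Real.pi / b) ^ ((n : ℝ) / 2) := by
  unfold gs
  rw [integral_sub_right_eq_self (fun x : Euc n => Real.exp (-b * ‖x‖ ^ 2)) y]
  rw [GaussianFourier.integral_rexp_neg_mul_sq_norm hb]
  simp

lemma gs_lim {n : ℕ} {b : ℝ} (hb : 0 < b) (y : Euc n) :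
    Tendsto (gs b y) (cocompact (Euc n)) (𝓝 0) := by
  unfold gs
  apply Real.tendsto_exp_atBot.comp
  apply Tendsto.const_mul_atTop_of_neg (by linarith)
  apply (tendsto_pow_atTop two_ne_zero).comp
  have h1 : Tendsto (fun x : Euc n => ‖x‖ - ‖y‖) (cocompact (Euc n)) atTop :=
    tendsto_atTop_add_const_right _ _ (tendsto_norm_cocompact_atTop)
  exact tendsto_atTop_mono (fun x => norm_sub_norm_le x y) h1

/-- package of regularity properties -/
structure Good {n : ℕ} (f : Euc n → ℝ) : Prop where
  sm : ContDiff ℝ (⊤ : ℕ∞) f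
  i0 : Integrable f
  i1 : ∀ i, Integrable (pd i f)
  i2 : ∀ i j, Integrable (pd i (pd j f))
  lim : Tendsto f (cocompact (Euc n)) (𝓝 0)
  grad : ∀ N : ℕ, ∃ C, ∀ x, ‖fderiv ℝ f x‖ * (1 + ‖x‖ ^ 2) ^ N ≤ C

lemma pd_sub {n : ℕ} {f g : Euc n → ℝ} (hf : ContDiff ℝ (⊤ : ℕ∞) f) (hg : ContDiff ℝ (⊤ : ℕ∞) g)
    (i : Fin n) : pd i (fun x => f x - g x) = fun x => pd i f x - pd i g x := by
  funext x
  simp only [pd]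
  rw [fderiv_fun_sub (hf.differentiable (by simp) x) (hg.differentiable (by simp) x)]
  simp

lemma pd_const_mul {n : ℕ} {f : Euc n → ℝ} (hf : ContDiff ℝ (⊤ : ℕ∞) f) (c : ℝ)
    (i : Fin n) : pd i (fun x => c * f x) = fun x => c * pd i f x := by
  funext x
  simp only [pd]
  rw [fderiv_const_mul (hf.differentiable (by simp) x)]
  simp

lemma lap_sub {n : ℕ} {f g : Euc n → ℝ} (hf : ContDiff ℝ (⊤ : ℕ∞) f) (hg : ContDiff ℝ (⊤ : ℕ∞) g)
    (x : Euc n) : lap (fun x => f x - g x) x = lap f x - lap g x := by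
  unfold lap
  rw [← Finset.sum_sub_distrib]
  refine Finset.sum_congr rfl fun i _ => ?_
  rw [pd_sub hf hg, pd_sub (pd_contDiff hf i) (pd_contDiff hg i)]

lemma lap_const_mul {n : ℕ} {f : Euc n → ℝ} (hf : ContDiff ℝ (⊤ : ℕ∞) f) (c : ℝ)
    (x : Euc n) : lap (fun x => c * f x) x = c * lap f x := by
  unfold lap
  rw [Finset.mul_sum]
  refine Finset.sum_congr rfl fun i _ => ?_
  rw [pd_const_mul hf, pd_const_mul (pd_contDiff hf i)]

lemma Good.sub {n : ℕ} {f g : Euc n → ℝ} (hf : Good f) (hg : Good g) :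
    Good (fun x => f x - g x) where
  sm := hf.sm.sub hg.sm
  i0 := hf.i0.sub hg.i0
  i1 i := by rw [pd_sub hf.sm hg.sm]; exact (hf.i1 i).sub (hg.i1 i)
  i2 i j := by
    rw [pd_sub hf.sm hg.sm, pd_sub (pd_contDiff hf.sm j) (pd_contDiff hg.sm j)]
    exact (hf.i2 i j).sub (hg.i2 i j)
  lim := by simpa using hf.lim.sub hg.lim
  grad N := by
    obtain ⟨C, hC⟩ := hf.grad N
    obtain ⟨C', hC'⟩ := hg.grad N
    refine ⟨C + C', fun x => ?_⟩
    rw [fderiv_fun_sub (hf.sm.differentiable (by simp) x) (hg.sm.differentiable (by simp) x)]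
    refine le_trans ?_ (add_le_add (hC x) (hC' x))
    rw [← add_mul]
    gcongr
    exact norm_sub_le _ _

lemma Good.const_mul {n : ℕ} {f : Euc n → ℝ} (hf : Good f) (c : ℝ) :
    Good (fun x => c * f x) where
  sm := contDiff_const.mul hf.sm
  i0 := hf.i0.const_mul c
  i1 i := by rw [pd_const_mul hf.sm]; exact (hf.i1 i).const_mul c
  i2 i j := by
    rw [pd_const_mul hf.sm, pd_const_mul (pd_contDiff hf.sm j)]
    exact (hf.i2 i j).const_mul c
  lim := by simpa using hf.lim.const_mul c
  grad N := by
    obtain ⟨C, hC⟩ := hf.grad N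
    refine ⟨|c| * C, fun x => ?_⟩
    rw [fderiv_const_mul (hf.sm.differentiable (by simp) x), norm_smul, mul_assoc, Real.norm_eq_abs]
    gcongr
    exact hC x

lemma abs_coord_le {n : ℕ} (z : Euc n) (i : Fin n) : |z i| ≤ 1 + ‖z‖ ^ 2 := by
  have : ‖z i‖ ≤ ‖z‖ := PiLp.norm_apply_le z i
  rw [Real.norm_eq_abs] at this
  nlinarith [sq_nonneg (‖z‖ - 1), norm_nonneg z]

lemma Good.of_gs {n : ℕ} {b : ℝ} (hb : 0 < b) (y : Euc n) : Good (gs b y) where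
  sm := gs_smooth b y
  i0 := gs_integrable hb y
  i1 i := by
    obtain ⟨C, hC0, hC⟩ := gs_poly_bound (n := n) hb 1
    refine Integrable.mono' ((gs_integrable (half_pos hb) y).const_mul (2 * b * C))
      (pd_contDiff (gs_smooth b y) i).continuous.aestronglyMeasurable (ae_of_all _ fun x => ?_)
    rw [pd_gs, Real.norm_eq_abs, abs_mul, abs_mul, abs_of_pos (gs_pos _ _ _)]
    have h1 := abs_coord_le (x - y) i
    have h2 := hC y x
    rw [pow_one] at h2
    have : |-2 * b| = 2 * b := by rw [neg_mul, abs_neg, abs_of_pos (by positivity)]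
    rw [this, mul_assoc (2 * b), mul_assoc (2 * b) C]
    refine mul_le_mul_of_nonneg_left ?_ (by positivity)
    refine le_trans ?_ h2
    gcongr
    · exact (gs_pos _ _ _).le
    · exact h1
  i2 i j := by
    obtain ⟨C, hC0, hC⟩ := gs_poly_bound (n := n) hb 2
    refine Integrable.mono' ((gs_integrable (half_pos hb) y).const_mul ((4 * b ^ 2 + 2 * b) * C))
      (pd_contDiff (pd_contDiff (gs_smooth b y) j) i).continuous.aestronglyMeasurable
      (ae_of_all _ fun x => ?_)
    rw [pd_pd_gs, Real.norm_eq_abs, abs_mul, abs_of_pos (gs_pos _ _ _)]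
    have h1 := abs_coord_le (x - y) i
    have h1' := abs_coord_le (x - y) j
    have h2 := hC y x
    rw [mul_assoc (4 * b ^ 2 + 2 * b)]
    refine le_trans ?_ (mul_le_mul_of_nonneg_left h2 (by positivity))
    rw [← mul_assoc]
    gcongr
    · exact (gs_pos _ _ _).le
    · refine (abs_sub _ _).trans ?_
      rw [add_mul]
      have e : |4 * b ^ 2 * (x j - y j) * (x i - y i)| = 4 * b ^ 2 * (|x j - y j| * |x i - y i|) := by
        rw [abs_mul, abs_mul, abs_of_pos (show 0 < 4 * b ^ 2 by positivity)]; ring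
      rw [e]
      have h3 : 1 ≤ 1 + ‖x - y‖ ^ 2 := by linarith [sq_nonneg ‖x - y‖]
      refine add_le_add ?_ ?_
      · gcongr
        rw [sq]
        gcongr
        · exact h1'
        · exact h1
      · rw [abs_mul, abs_of_pos (show 0 < 2 * b by positivity)]
        gcongr
        refine le_trans ?_ (one_le_pow₀ h3)
        split_ifs <;> simp
  lim := gs_lim hb y
  grad N := by
    obtain ⟨C, hC0, hC⟩ := gs_poly_bound (n := n) hb (N + 1)
    refine ⟨2 * b * (2 * (1 + ‖y‖ ^ 2)) ^ N * C, fun x => ?_⟩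
    rw [(gs_hasFDerivAt b y x).fderiv, norm_smul, innerSL_apply_norm, Real.norm_eq_abs, abs_mul,
      abs_of_pos (gs_pos _ _ _)]
    have : |-2 * b| = 2 * b := by rw [neg_mul, abs_neg, abs_of_pos (by positivity)]
    rw [this]
    have h1 : 1 + ‖x‖ ^ 2 ≤ 2 * (1 + ‖y‖ ^ 2) * (1 + ‖x - y‖ ^ 2) := by
      have : ‖x‖ ≤ ‖x - y‖ + ‖y‖ := by simpa using norm_add_le (x - y) y
      have : ‖x‖ ^ 2 ≤ (‖x - y‖ + ‖y‖) ^ 2 := by gcongr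
      nlinarith [sq_nonneg (‖x - y‖ - ‖y‖), mul_nonneg (sq_nonneg ‖x - y‖) (sq_nonneg ‖y‖)]
    have h2 : ‖x - y‖ ≤ 1 + ‖x - y‖ ^ 2 := by nlinarith [sq_nonneg (‖x - y‖ - 1), norm_nonneg (x-y)]
    have h3 : gs (b/2) y x ≤ 1 := by
      apply Real.exp_le_one_iff.2
      nlinarith [sq_nonneg ‖x-y‖]
    have h4 := (hC y x).trans (mul_le_of_le_one_right hC0 h3)
    have hg := (gs_pos b y x).le
    calc 2 * b * gs b y x * ‖x - y‖ * (1 + ‖x‖ ^ 2) ^ N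
        ≤ 2 * b * gs b y x * (1 + ‖x - y‖ ^ 2) * (2 * (1 + ‖y‖ ^ 2) * (1 + ‖x - y‖ ^ 2)) ^ N := by
          gcongr
      _ = 2 * b * (2 * (1 + ‖y‖ ^ 2)) ^ N * ((1 + ‖x - y‖ ^ 2) ^ (N + 1) * gs b y x) := by
          rw [mul_pow, pow_succ]; ring
      _ ≤ _ := by gcongr

/-- reflection across the boundary of the half space -/
noncomputable def hrefl {d : ℕ} (y : Euc (d+1)) : Euc (d+1) :=
  y - (2 * y (Fin.last d)) • EuclideanSpace.single (Fin.last d) (1 : ℝ)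

lemma norm_sub_hrefl_sq {d : ℕ} (x y : Euc (d+1)) :
    ‖x - hrefl y‖ ^ 2 = ‖x - y‖ ^ 2 + 4 * x (Fin.last d) * y (Fin.last d) := by
  have : x - hrefl y = (x - y) + (2 * y (Fin.last d)) • EuclideanSpace.single (Fin.last d) (1 : ℝ) := by
    unfold hrefl; abel
  rw [this, norm_add_sq_real, norm_smul, inner_smul_right]
  simp [EuclideanSpace.inner_single_right, mul_pow]
  ring

lemma hrefl_last {d : ℕ} (y : Euc (d+1)) : hrefl y (Fin.last d) = - y (Fin.last d) := by
  simp [hrefl]; ring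

lemma hrefl_hrefl {d : ℕ} (y : Euc (d+1)) : hrefl (hrefl y) = y := by
  rw [hrefl, hrefl_last, hrefl]
  module

lemma continuous_hrefl {d : ℕ} : Continuous (hrefl (d := d)) := by
  unfold hrefl; fun_prop

lemma gs_hrefl {d : ℕ} (b : ℝ) (y x : Euc (d+1)) : gs b (hrefl y) x = gs b y (hrefl x) := by
  unfold gs
  rw [norm_sub_hrefl_sq, norm_sub_rev (hrefl x), norm_sub_hrefl_sq, norm_sub_rev x]
  ring_nf

lemma isOpen_halfSpace (d : ℕ) : IsOpen (halfSpace d) := by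
  unfold halfSpace
  exact isOpen_lt continuous_const (by fun_prop)

/-- hypothesis of the theorem -/
def WeakHyp (d : ℕ) (T : ℝ) (u : ℝ → Euc (d+1) → ℝ) : Prop :=
  ∀ φ : ℝ → Euc (d+1) → ℝ,
      (∀ t ∈ Set.Icc 0 T, ContDiffOn ℝ 2 (φ t) (halfSpace d)) →
      (∀ t ∈ Set.Icc 0 T, MemW (halfSpace d) 1 2 (φ t)) →
      (∀ t ∈ Set.Icc 0 T, MemW10 (halfSpace d) 1 (φ t)) →
      (∀ t ∈ Set.Icc 0 T, ContinuousOn (φ t) (halfSpace d)) →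
      (∀ x ∈ halfSpace d, ∀ t ∈ Set.Icc 0 T,
        DifferentiableAt ℝ (fun s => φ s x) t) →
      (∀ t ∈ Set.Icc 0 T,
        MemLp (fun x => deriv (fun s => φ s x) t) 1
          (volume.restrict (halfSpace d))) →
      (∀ t₀ ∈ Set.Icc 0 T,
        Tendsto (fun s =>
            eLpNorm (fun x => φ s x - φ t₀ x) 1 (volume.restrict (halfSpace d)))
          (𝓝[Set.Icc 0 T] t₀) (𝓝 0)) →
      (∀ t₀ ∈ Set.Icc 0 T,
        Tendsto (fun s =>
            eLpNorm (fun x => deriv (fun r => φ r x) s - deriv (fun r => φ r x) t₀)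
              1 (volume.restrict (halfSpace d)))
          (𝓝[Set.Icc 0 T] t₀) (𝓝 0)) →
      (∃ Cφ : ℝ, ∀ t ∈ Set.Icc 0 T, ∀ x ∈ halfSpace d,
        ‖fderiv ℝ (φ t) x‖ ≤ Cφ * (1 + ‖x‖ ^ 2) ^ (-((d : ℝ) + 1) / 2)) →
      ∫ s in Set.Ioo 0 T,
        ∫ x in halfSpace d,
          u s x * (deriv (fun r => φ r x) s + lap (φ s) x) = 0

lemma use_weak {d : ℕ} {T : ℝ} {u : ℝ → Euc (d+1) → ℝ} (h : WeakHyp d T u)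
    {f : Euc (d+1) → ℝ} (hf : Good f)
    (hpos : ∀ x ∈ halfSpace d, 0 < f x) (hneg : ∀ x ∉ halfSpace d, f x ≤ 0)
    {η : ℝ → ℝ} (hη : ContDiff ℝ (⊤ : ℕ∞) η) (hη0 : ∀ t, 0 < η t) :
    ∫ s in Set.Ioo 0 T, ∫ x in halfSpace d,
      u s x * (deriv η s * f x + η s * lap f x) = 0 := by
  have hd : ∀ x s, deriv (fun r => η r * f x) s = deriv η s * f x := by
    intro x s
    exact deriv_mul_const (hη.differentiable (by simp) s) _
  have hdc : Continuous (deriv η) := hη.continuous_deriv (by simp)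
  have hcont : ∀ (g : ℝ → ℝ), Continuous g → ∀ t₀ ∈ Set.Icc 0 T,
        Tendsto (fun s =>
            eLpNorm (fun x => g s * f x - g t₀ * f x) 1 (volume.restrict (halfSpace d)))
          (𝓝[Set.Icc 0 T] t₀) (𝓝 0) := by
    intro g hg t₀ _
    have e : ∀ s, eLpNorm (fun x => g s * f x - g t₀ * f x) 1 (volume.restrict (halfSpace d)) =
        ‖g s - g t₀‖ₑ * eLpNorm f 1 (volume.restrict (halfSpace d)) := by
      intro s
      rw [← eLpNorm_const_smul]
      congr 1
      funext x
      simp [sub_mul]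
    simp_rw [e]
    have hfin : eLpNorm f 1 (volume.restrict (halfSpace d)) ≠ ∞ :=
      (memLp_one_iff_integrable.2 hf.i0.restrict).2.ne
    have h1 : Tendsto (fun s => ‖g s - g t₀‖ₑ) (𝓝[Set.Icc 0 T] t₀) (𝓝 0) := by
      have : Continuous (fun s => ‖g s - g t₀‖ₑ) := (hg.sub continuous_const).enorm
      have h2 := (this.tendsto t₀)
      simp only [sub_self, enorm_zero] at h2
      exact h2.mono_left nhdsWithin_le_nhds
    simpa using ENNReal.Tendsto.mul_const h1 (Or.inr hfin)
  have := h (fun t x => η t * f x) ?_ ?_ ?_ ?_ ?_ ?_ ?_ ?_ ?_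
  · simp_rw [hd, lap_const_mul hf.sm] at this
    exact this
  · intro t _
    exact (by exact_mod_cast contDiff_infty.1 (hf.const_mul (η t)).sm 2 : ContDiff ℝ 2 _).contDiffOn
  · intro t _
    have g := hf.const_mul (η t)
    exact memW_of_smooth _ g.sm g.i0 g.i1 g.i2
  · intro t _
    have g := hf.const_mul (η t)
    exact memW10_of_smooth (isOpen_halfSpace d).measurableSet g.sm g.i0 g.i1
      (fun x hx => mul_pos (hη0 t) (hpos x hx))
      (fun x hx => mul_nonpos_of_nonneg_of_nonpos (hη0 t).le (hneg x hx)) g.lim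
  · intro t _
    exact (hf.const_mul (η t)).sm.continuous.continuousOn
  · intro x _ t _
    exact (hη.differentiable (by simp) t).mul_const _
  · intro t _
    simp_rw [hd]
    exact memLp_one_iff_integrable.2 (hf.const_mul _).i0.restrict
  · exact hcont η hη.continuous
  · simp_rw [hd]
    exact hcont _ hdc
  · obtain ⟨C, hC⟩ := hf.grad (d + 1)
    have hC0 : 0 ≤ C := le_trans (by positivity) (hC 0)
    obtain ⟨A, hA⟩ := (isCompact_Icc (a := (0:ℝ)) (b := T)).exists_bound_of_continuousOn
      hη.continuous.continuousOn
    refine ⟨A * C, fun t ht x _ => ?_⟩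
    rw [fderiv_const_mul (hf.sm.differentiable (by simp) x), norm_smul, mul_assoc]
    have hA0 : 0 ≤ A := (norm_nonneg _).trans (hA t ht)
    refine mul_le_mul (hA t ht) ?_ (norm_nonneg _) hA0
    have h1 : (1:ℝ) ≤ 1 + ‖x‖ ^ 2 := by linarith [sq_nonneg ‖x‖]
    have h0 : (0:ℝ) < 1 + ‖x‖ ^ 2 := by linarith
    have h2 : (1 + ‖x‖ ^ 2) ^ (((d:ℝ) + 1) / 2) ≤ (1 + ‖x‖ ^ 2) ^ (d + 1) := by
      rw [← Real.rpow_natCast (1 + ‖x‖ ^ 2) (d + 1)]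
      apply Real.rpow_le_rpow_of_exponent_le h1
      push_cast
      have : (0:ℝ) ≤ d := by positivity
      linarith
    rw [neg_div, Real.rpow_neg h0.le, ← div_eq_mul_inv, le_div_iff₀ (by positivity)]
    exact (mul_le_mul_of_nonneg_left h2 (norm_nonneg _)).trans (hC x)

/-- Gaussian in time -/
noncomputable def tg (a τ t : ℝ) : ℝ := Real.exp (-a * (t - τ) ^ 2)

lemma tg_pos (a τ t : ℝ) : 0 < tg a τ t := Real.exp_pos _

lemma tg_le_one {a : ℝ} (ha : 0 < a) (τ t : ℝ) : tg a τ t ≤ 1 :=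
  Real.exp_le_one_iff.2 (by nlinarith [sq_nonneg (t - τ)])

lemma tg_hasDerivAt (a τ t : ℝ) : HasDerivAt (tg a τ) (-2 * a * (t - τ) * tg a τ t) t := by
  have h1 : HasDerivAt (fun t => -a * (t - τ) ^ 2) (-a * (2 * (t - τ))) t := by
    have := (((hasDerivAt_id t).sub_const τ).pow 2).const_mul (-a)
    simpa using this
  convert! h1.exp using 1
  simp only [tg]; ring

lemma tg_smooth (a τ : ℝ) : ContDiff ℝ (⊤ : ℕ∞) (tg a τ) := by
  unfold tg; fun_prop

lemma tg_deriv_bound {a : ℝ} (ha : 0 < a) : ∃ C : ℝ, 0 ≤ C ∧ ∀ τ t, |-2 * a * (t - τ) * tg a τ t| ≤ C := by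
  obtain ⟨C, hC0, hC⟩ := mul_exp_bound ha 1
  refine ⟨2 * a * C, by positivity, fun τ t => ?_⟩
  have h := hC ((t - τ) ^ 2) (sq_nonneg _)
  rw [pow_one] at h
  rw [abs_mul, abs_mul, abs_of_pos (tg_pos _ _ _)]
  have : |-2 * a| = 2 * a := by rw [neg_mul, abs_neg, abs_of_pos (by positivity)]
  rw [this, mul_assoc]
  refine mul_le_mul_of_nonneg_left (le_trans ?_ h) (by positivity)
  unfold tg
  gcongr
  nlinarith [sq_nonneg (|t - τ| - 1), sq_abs (t - τ)]

/-- heat kernel (up to a constant) -/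
noncomputable def hk {n : ℕ} (z : Euc n) (s : ℝ) (x : Euc n) : ℝ :=
  s ^ (-((n : ℝ) / 2)) * gs (1 / (4 * s)) z x

lemma hk_pos {n : ℕ} (z : Euc n) {s : ℝ} (hs : 0 < s) (x : Euc n) : 0 < hk z s x :=
  mul_pos (Real.rpow_pos_of_pos hs _) (gs_pos _ _ _)

lemma Good.of_hk {n : ℕ} (z : Euc n) {s : ℝ} (hs : 0 < s) : Good (hk z s) :=
  (Good.of_gs (by positivity) z).const_mul _

lemma lap_hk {n : ℕ} (z : Euc n) {s : ℝ} (hs : 0 < s) (x : Euc n) :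
    lap (hk z s) x = (‖x - z‖ ^ 2 / (4 * s ^ 2) - n / (2 * s)) * hk z s x := by
  unfold hk
  rw [lap_const_mul (gs_smooth _ _), lap_gs]
  field_simp
  ring

lemma hk_hasDerivAt {n : ℕ} (z : Euc n) {s : ℝ} (hs : 0 < s) (x : Euc n) :
    HasDerivAt (fun s => hk z s x) (lap (hk z s) x) s := by
  rw [lap_hk z hs]
  have h1 : HasDerivAt (fun s : ℝ => s ^ (-((n : ℝ) / 2))) (-((n : ℝ) / 2) * s ^ (-((n : ℝ) / 2) - 1)) s :=
    Real.hasDerivAt_rpow_const (Or.inl hs.ne')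
  have h2 : HasDerivAt (fun s : ℝ => -(1 / (4 * s)) * ‖x - z‖ ^ 2) (‖x - z‖ ^ 2 / (4 * s ^ 2)) s := by
    have h3 := ((hasDerivAt_inv hs.ne').const_mul (-(1 / 4) * ‖x - z‖ ^ 2))
    have e : (fun s : ℝ => -(1 / (4 * s)) * ‖x - z‖ ^ 2) = fun s => (-(1 / 4) * ‖x - z‖ ^ 2) * s⁻¹ := by
      funext s; rw [one_div, mul_inv]; ring
    rw [e]
    refine h3.congr_deriv ?_
    field_simp
  refine (h1.mul h2.exp).congr_deriv ?_
  rw [Real.rpow_sub_one hs.ne']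
  simp only [hk, gs]
  field_simp
  ring

lemma hk_integral {n : ℕ} (z : Euc n) {s : ℝ} (hs : 0 < s) :
    ∫ x, hk z s x = (4 * Real.pi) ^ ((n : ℝ) / 2) := by
  unfold hk
  rw [integral_const_mul, gs_integral (by positivity)]
  have : Real.pi / (1 / (4 * s)) = 4 * Real.pi * s := by field_simp
  rw [this, Real.mul_rpow (by positivity) hs.le, mul_left_comm, ← Real.rpow_add hs]
  simp

lemma gs_mono {n : ℕ} {b c : ℝ} (h : c ≤ b) (z x : Euc n) : gs b z x ≤ gs c z x := by
  unfold gs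
  apply Real.exp_le_exp.2
  nlinarith [sq_nonneg ‖x - z‖]

lemma hk_bounds {n : ℕ} (z : Euc n) {s₀ : ℝ} (hs₀ : 0 < s₀) :
    ∃ C : ℝ, 0 ≤ C ∧ ∀ s ∈ Ioo (s₀ / 2) (2 * s₀), ∀ x,
      hk z s x ≤ C * gs (1 / (8 * s₀) / 2) z x ∧ |lap (hk z s) x| ≤ C * gs (1 / (8 * s₀) / 2) z x := by
  have hb : 0 < 1 / (8 * s₀) := by positivity
  obtain ⟨C, hC0, hC⟩ := gs_poly_bound (n := n) hb 1
  set P := (s₀ / 2) ^ (-((n : ℝ) / 2)) with hP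
  have hP0 : 0 < P := by positivity
  set A : ℝ := 1 + 1 / s₀ ^ 2 + n / s₀ with hA
  have hA1 : 1 ≤ A := by
    have : 0 ≤ 1 / s₀ ^ 2 + n / s₀ := by positivity
    linarith
  refine ⟨A * P * C, by positivity, fun s hs x => ?_⟩
  have hs0 : 0 < s := lt_trans (by positivity) hs.1
  have h1 : hk z s x ≤ P * gs (1 / (8 * s₀)) z x := by
    unfold hk
    have e1 : s ^ (-((n : ℝ) / 2)) ≤ P := by
      apply Real.rpow_le_rpow_of_nonpos (by positivity) hs.1.le
      have : (0:ℝ) ≤ n := by positivity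
      linarith
    have e2 : gs (1 / (4 * s)) z x ≤ gs (1 / (8 * s₀)) z x := by
      apply gs_mono
      apply one_div_le_one_div_of_le (by positivity)
      linarith [hs.2]
    exact mul_le_mul e1 e2 (gs_pos _ _ _).le hP0.le
  have h2 := hC z x
  rw [pow_one] at h2
  have hr : 0 ≤ ‖x - z‖ ^ 2 := sq_nonneg _
  have key : ∀ B, 0 ≤ B → B ≤ A * (1 + ‖x - z‖ ^ 2) → B * hk z s x ≤ A * P * C * gs (1 / (8 * s₀) / 2) z x := by
    intro B hB0 hB
    calc B * hk z s x ≤ (A * (1 + ‖x - z‖ ^ 2)) * (P * gs (1 / (8 * s₀)) z x) :=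
          mul_le_mul hB h1 (hk_pos z hs0 x).le (by positivity)
      _ = A * P * ((1 + ‖x - z‖ ^ 2) * gs (1 / (8 * s₀)) z x) := by ring
      _ ≤ A * P * (C * gs (1 / (8 * s₀) / 2) z x) := by gcongr
      _ = _ := by ring
  constructor
  · have := key 1 (by norm_num) (by nlinarith)
    simpa using this
  · rw [lap_hk z hs0, abs_mul, abs_of_pos (hk_pos z hs0 x)]
    apply key _ (abs_nonneg _)
    refine (abs_sub _ _).trans ?_
    rw [abs_of_nonneg (by positivity), abs_of_nonneg (by positivity)]
    have e1 : ‖x - z‖ ^ 2 / (4 * s ^ 2) ≤ (1 / s₀ ^ 2) * ‖x - z‖ ^ 2 := by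
      rw [div_eq_mul_one_div, mul_comm]
      gcongr
      nlinarith [hs.1]
    have e2 : (n:ℝ) / (2 * s) ≤ n / s₀ := by
      gcongr
      linarith [hs.1]
    have e3 : 0 ≤ (n:ℝ) / s₀ := by positivity
    have e4 : 0 ≤ 1 / s₀ ^ 2 := by positivity
    nlinarith [mul_nonneg e3 hr]

/-- space-time measure -/
noncomputable abbrev stm (d : ℕ) (T : ℝ) : Measure (ℝ × Euc (d+1)) :=
  (volume.restrict (Set.Ioo (0:ℝ) T)).prod (volume.restrict (halfSpace d))

lemma J_hasDeriv {d : ℕ} {T : ℝ} {u : ℝ → Euc (d+1) → ℝ}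
    (humeas : Measurable (Function.uncurry u)) {M : ℝ} (hM : ∀ t x, |u t x| ≤ M)
    {a : ℝ} (ha : 0 < a) (τ : ℝ) (z : Euc (d+1)) {s₀ : ℝ} (hs₀ : 0 < s₀) :
    Integrable (fun q : ℝ × Euc (d+1) => u q.1 q.2 * (deriv (fun t => tg a τ (t + s₀)) q.1 * hk z s₀ q.2
      + tg a τ (q.1 + s₀) * lap (hk z s₀) q.2)) (stm d T) ∧
    HasDerivAt (fun s => ∫ q, u q.1 q.2 * (tg a τ (q.1 + s) * hk z s q.2) ∂(stm d T))
      (∫ q, u q.1 q.2 * (deriv (fun t => tg a τ (t + s₀)) q.1 * hk z s₀ q.2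
      + tg a τ (q.1 + s₀) * lap (hk z s₀) q.2) ∂(stm d T)) s₀ := by
  obtain ⟨C, hC0, hC⟩ := hk_bounds z hs₀
  obtain ⟨C', hC0', hC'⟩ := tg_deriv_bound ha
  have hM0 : 0 ≤ M := (abs_nonneg _).trans (hM 0 0)
  have hb : 0 < 1 / (8 * s₀) / 2 := by positivity
  have hGint : Integrable (fun q : ℝ × Euc (d+1) => gs (1 / (8 * s₀) / 2) z q.2) (stm d T) :=
    ((gs_integrable hb z).restrict).comp_snd _
  have hum : Measurable (fun q : ℝ × Euc (d+1) => u q.1 q.2) := humeas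
  have hmem : s₀ ∈ Ioo (s₀ / 2) (2 * s₀) := ⟨by linarith, by linarith⟩
  have hder : ∀ s t, deriv (fun t => tg a τ (t + s)) t = -2 * a * (t + s - τ) * tg a τ (t + s) := by
    intro s t
    rw [deriv_comp_add_const]
    exact (tg_hasDerivAt a τ (t + s)).deriv
  have htc : Continuous (tg a τ) := (tg_smooth a τ).continuous
  have hmeas : ∀ s, 0 < s → AEStronglyMeasurable (fun q : ℝ × Euc (d+1) =>
      u q.1 q.2 * (tg a τ (q.1 + s) * hk z s q.2)) (stm d T) := by
    intro s hs
    apply (hum.aestronglyMeasurable).mul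
    have := (Good.of_hk z hs).sm.continuous
    exact Continuous.aestronglyMeasurable (by fun_prop)
  have hb1 : ∀ s ∈ Ioo (s₀ / 2) (2 * s₀), ∀ q : ℝ × Euc (d+1),
      ‖u q.1 q.2 * (tg a τ (q.1 + s) * hk z s q.2)‖ ≤ M * C * gs (1 / (8 * s₀) / 2) z q.2 := by
    intro s hs q
    have hs0 : 0 < s := lt_trans (by positivity) hs.1
    rw [Real.norm_eq_abs, abs_mul, mul_assoc]
    refine mul_le_mul (hM _ _) ?_ (abs_nonneg _) hM0
    rw [abs_of_pos (mul_pos (tg_pos _ _ _) (hk_pos z hs0 _))]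
    refine le_trans ?_ (hC s hs q.2).1
    exact mul_le_of_le_one_left (hk_pos z hs0 _).le (tg_le_one ha _ _)
  refine hasDerivAt_integral_of_dominated_loc_of_deriv_le (μ := stm d T)
    (F := fun s (q : ℝ × Euc (d+1)) => u q.1 q.2 * (tg a τ (q.1 + s) * hk z s q.2))
    (F' := fun s (q : ℝ × Euc (d+1)) => u q.1 q.2 * (deriv (fun t => tg a τ (t + s)) q.1 * hk z s q.2
      + tg a τ (q.1 + s) * lap (hk z s) q.2)) (x₀ := s₀) (s := Ioo (s₀ / 2) (2 * s₀))
    (bound := fun q => M * (C' * C + C) * gs (1 / (8 * s₀) / 2) z q.2)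
    (Ioo_mem_nhds hmem.1 hmem.2) ?_ ?_ ?_ ?_ ?_ ?_
  · filter_upwards [lt_mem_nhds hs₀] with s hs using hmeas s hs
  · exact Integrable.mono' (hGint.const_mul (M * C)) (hmeas _ hs₀) (ae_of_all _ (hb1 s₀ hmem))
  · apply (hum.aestronglyMeasurable).mul
    have h1 := (Good.of_hk z hs₀).sm.continuous
    have h2 : Continuous (lap (hk z s₀)) := by
      unfold lap
      exact continuous_finsetSum _ fun i _ =>
        (pd_contDiff (pd_contDiff (Good.of_hk z hs₀).sm i) i).continuous
    simp_rw [hder]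
    exact Continuous.aestronglyMeasurable (by fun_prop)
  · refine ae_of_all _ fun q s hs => ?_
    have hs0 : 0 < s := lt_trans (by positivity) hs.1
    obtain ⟨e1, e2⟩ := hC s hs q.2
    rw [Real.norm_eq_abs, abs_mul, mul_assoc]
    refine mul_le_mul (hM _ _) ?_ (abs_nonneg _) hM0
    refine (abs_add_le _ _).trans ?_
    rw [add_mul, hder, abs_mul, abs_mul (tg _ _ _), abs_of_pos (hk_pos z hs0 _), abs_of_pos (tg_pos _ _ _)]
    refine add_le_add ?_ ?_
    · rw [mul_assoc C']
      exact mul_le_mul (hC' _ _) e1 (hk_pos z hs0 _).le hC0'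
    · exact (mul_le_of_le_one_left (abs_nonneg _) (tg_le_one ha _ _)).trans e2
  · exact hGint.const_mul _
  · refine ae_of_all _ fun q s hs => ?_
    have hs0 : 0 < s := lt_trans (by positivity) hs.1
    rw [hder]
    apply HasDerivAt.const_mul
    have h1 : HasDerivAt (fun s => tg a τ (q.1 + s)) (-2 * a * (q.1 + s - τ) * tg a τ (q.1 + s)) s :=
      (tg_hasDerivAt a τ (q.1 + s)).comp_const_add q.1 s
    exact h1.mul (hk_hasDerivAt z hs0 q.2)

lemma J_lim {d : ℕ} {T : ℝ} (hT : 0 < T) {u : ℝ → Euc (d+1) → ℝ}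
    {M : ℝ} (hM : ∀ t x, |u t x| ≤ M)
    {a : ℝ} (ha : 0 < a) (τ : ℝ) (z : Euc (d+1)) :
    Tendsto (fun s => ∫ q, u q.1 q.2 * (tg a τ (q.1 + s) * hk z s q.2) ∂(stm d T)) atTop (𝓝 0) := by
  have hM0 : 0 ≤ M := (abs_nonneg _).trans (hM 0 0)
  have hlim : Tendsto (fun s => M * (T * (4 * Real.pi) ^ (((d+1 : ℕ) : ℝ) / 2)) * tg a τ s) atTop (𝓝 0) := by
    have : Tendsto (tg a τ) atTop (𝓝 0) := by
      unfold tg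
      apply Real.tendsto_exp_atBot.comp
      apply Tendsto.const_mul_atTop_of_neg (by linarith)
      apply (tendsto_pow_atTop two_ne_zero).comp
      exact tendsto_atTop_add_const_right _ _ tendsto_id
    simpa using this.const_mul (M * (T * (4 * Real.pi) ^ (((d+1 : ℕ) : ℝ) / 2)))
  refine squeeze_zero_norm' ?_ hlim
  filter_upwards [eventually_gt_atTop τ, eventually_gt_atTop 0] with s hsτ hs
  have hi : Integrable (fun q : ℝ × Euc (d+1) => hk z s q.2) (stm d T) :=
    ((Good.of_hk z hs).i0.restrict).comp_snd _
  have hae : ∀ᵐ q ∂(stm d T), q.1 ∈ Ioo (0:ℝ) T := by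
    rw [stm, Measure.prod_restrict]
    filter_upwards [ae_restrict_mem (measurableSet_Ioo.prod (isOpen_halfSpace d).measurableSet)] with q hq
      using hq.1
  refine (norm_integral_le_of_norm_le (hi.const_mul (M * tg a τ s)) ?_).trans ?_
  · filter_upwards [hae] with q hq
    rw [Real.norm_eq_abs, abs_mul, mul_assoc]
    refine mul_le_mul (hM _ _) ?_ (abs_nonneg _) hM0
    rw [abs_of_pos (mul_pos (tg_pos _ _ _) (hk_pos z hs _))]
    refine mul_le_mul_of_nonneg_right ?_ (hk_pos z hs _).le
    unfold tg
    apply Real.exp_le_exp.2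
    have := hq.1
    nlinarith [mul_pos ha this, mul_pos (mul_pos ha this) (sub_pos.2 hsτ)]
  · rw [integral_const_mul]
    have e : ∫ q, hk z s q.2 ∂(stm d T) = T * ∫ x in halfSpace d, hk z s x := by
      have := integral_prod_mul (μ := volume.restrict (Ioo (0:ℝ) T)) (ν := volume.restrict (halfSpace d))
        (fun _ => (1:ℝ)) (hk z s)
      simp only [one_mul] at this
      rw [this]
      simp [hT.le]
    rw [e]
    have h1 : ∫ x in halfSpace d, hk z s x ≤ (4 * Real.pi) ^ (((d+1 : ℕ) : ℝ) / 2) := by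
      rw [← hk_integral z hs]
      exact setIntegral_le_integral (Good.of_hk z hs).i0 (ae_of_all _ fun x => (hk_pos z hs x).le)
    have := tg_pos a τ s
    calc M * tg a τ s * (T * ∫ x in halfSpace d, hk z s x)
        ≤ M * tg a τ s * (T * (4 * Real.pi) ^ (((d+1 : ℕ) : ℝ) / 2)) := by gcongr
      _ = _ := by ring

lemma J_zero {d : ℕ} {T : ℝ} (hT : 0 < T) {u : ℝ → Euc (d+1) → ℝ}
    (humeas : Measurable (Function.uncurry u)) {M : ℝ} (hM : ∀ t x, |u t x| ≤ M)
    (h : WeakHyp d T u) {a : ℝ} (ha : 0 < a) (τ : ℝ) {y : Euc (d+1)} (hy : y ∈ halfSpace d)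
    {s₀ : ℝ} (hs₀ : 0 < s₀) :
    ∫ q, u q.1 q.2 * (tg a τ (q.1 + s₀) * hk y s₀ q.2) ∂(stm d T) =
    ∫ q, u q.1 q.2 * (tg a τ (q.1 + s₀) * hk (hrefl y) s₀ q.2) ∂(stm d T) := by
  set J : ℝ → ℝ := fun s => (∫ q, u q.1 q.2 * (tg a τ (q.1 + s) * hk y s q.2) ∂(stm d T)) -
    ∫ q, u q.1 q.2 * (tg a τ (q.1 + s) * hk (hrefl y) s q.2) ∂(stm d T) with hJ
  have hd : ∀ s, 0 < s → HasDerivAt J 0 s := by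
    intro s hs
    obtain ⟨i1, d1⟩ := J_hasDeriv (T := T) humeas hM ha τ y hs
    obtain ⟨i2, d2⟩ := J_hasDeriv (T := T) humeas hM ha τ (hrefl y) hs
    refine (d1.sub d2).congr_deriv ?_
    rw [← integral_sub' i1 i2, integral_prod _ (i1.sub i2)]
    have g1 := Good.of_hk y hs
    have g2 := Good.of_hk (hrefl y) hs
    have hb : 0 < 1 / (4 * s) := by positivity
    have hy' : 0 < y (Fin.last d) := hy
    refine Eq.trans ?_ (use_weak h (g1.sub g2) (η := fun t => tg a τ (t + s)) ?_ ?_ ?_ ?_)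
    · congr 1
      funext t
      congr 1
      funext x
      rw [lap_sub g1.sm g2.sm]
      simp only [Pi.sub_apply]
      ring
    · intro x hx
      have hx' : 0 < x (Fin.last d) := hx
      rw [sub_pos]
      unfold hk gs
      rw [norm_sub_hrefl_sq]
      refine mul_lt_mul_of_pos_left (Real.exp_lt_exp.2 ?_) (Real.rpow_pos_of_pos hs _)
      have := mul_pos hb (mul_pos hx' hy')
      nlinarith
    · intro x hx
      have hx' : x (Fin.last d) ≤ 0 := not_lt.1 hx
      rw [sub_nonpos]
      unfold hk gs
      rw [norm_sub_hrefl_sq]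
      refine mul_le_mul_of_nonneg_left (Real.exp_le_exp.2 ?_) (Real.rpow_pos_of_pos hs _).le
      have := mul_nonneg hb.le (mul_nonneg (neg_nonneg.2 hx') hy'.le)
      nlinarith
    · exact (tg_smooth a τ).comp (contDiff_id.add contDiff_const)
    · intro t; exact tg_pos _ _ _
  have hconst : ∀ s, s₀ ≤ s → J s = J s₀ := by
    intro s hs
    refine (convex_Ioi (0:ℝ)).is_const_of_fderivWithin_eq_zero (𝕜 := ℝ)
      (fun x hx => (hd x hx).differentiableAt.differentiableWithinAt) ?_
      (show s ∈ Ioi (0:ℝ) from lt_of_lt_of_le hs₀ hs) hs₀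
    intro x hx
    rw [(hd x hx).hasFDerivAt.hasFDerivWithinAt.fderivWithin (isOpen_Ioi.uniqueDiffWithinAt hx)]
    ext; simp
  have hlim : Tendsto J atTop (𝓝 0) := by
    simpa using (J_lim hT hM ha τ y).sub (J_lim hT hM ha τ (hrefl y))
  have hlim2 : Tendsto J atTop (𝓝 (J s₀)) := by
    apply tendsto_const_nhds.congr'
    filter_upwards [eventually_ge_atTop s₀] with s hs using (hconst s hs).symm
  have := tendsto_nhds_unique hlim2 hlim
  exact sub_eq_zero.1 this

lemma G_zero {d : ℕ} {T : ℝ} (hT : 0 < T) {u : ℝ → Euc (d+1) → ℝ}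
    (humeas : Measurable (Function.uncurry u)) {M : ℝ} (hM : ∀ t x, |u t x| ≤ M)
    (h : WeakHyp d T u) {a b : ℝ} (ha : 0 < a) (hb : 0 < b) (τ : ℝ) (y : Euc (d+1)) :
    ∫ q, u q.1 q.2 * (tg a τ q.1 * gs b y q.2) ∂(stm d T) =
    ∫ q, u q.1 q.2 * (tg a τ q.1 * gs b (hrefl y) q.2) ∂(stm d T) := by
  have main : ∀ y ∈ halfSpace d, ∫ q, u q.1 q.2 * (tg a τ q.1 * gs b y q.2) ∂(stm d T) =
    ∫ q, u q.1 q.2 * (tg a τ q.1 * gs b (hrefl y) q.2) ∂(stm d T) := by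
    intro y hy
    have hs : 0 < 1 / (4 * b) := by positivity
    have := J_zero hT humeas hM h ha (τ + 1 / (4 * b)) hy hs
    have e : ∀ z, (fun q : ℝ × Euc (d+1) => u q.1 q.2 *
        (tg a (τ + 1 / (4 * b)) (q.1 + 1 / (4 * b)) * hk z (1 / (4 * b)) q.2)) =
        fun q => (1 / (4 * b)) ^ (-(((d+1 : ℕ) : ℝ) / 2)) * (u q.1 q.2 * (tg a τ q.1 * gs b z q.2)) := by
      intro z
      funext q
      have e1 : 1 / (4 * (1 / (4 * b))) = b := by field_simp
      unfold hk tg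
      rw [e1, add_sub_add_right_eq_sub]
      ring
    rw [e, e, integral_const_mul, integral_const_mul] at this
    exact mul_left_cancel₀ (Real.rpow_pos_of_pos hs _).ne' this
  rcases lt_trichotomy (y (Fin.last d)) 0 with hy | hy | hy
  · have h1 : hrefl y ∈ halfSpace d := by
      show 0 < hrefl y (Fin.last d)
      rw [hrefl_last]; linarith
    have := main _ h1
    rw [hrefl_hrefl] at this
    exact this.symm
  · have : hrefl y = y := by simp [hrefl, hy]
    rw [this]
  · exact main y hy

lemma tg_mul {a a' : ℝ} (ha : 0 < a) (ha' : 0 < a') (τ τ' : ℝ) : ∃ c τ₂ : ℝ, ∀ t,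
    tg a τ t * tg a' τ' t = c * tg (a + a') τ₂ t := by
  refine ⟨Real.exp (-(a * τ ^ 2 + a' * τ' ^ 2) + (a + a') * ((a * τ + a' * τ') / (a + a')) ^ 2),
    (a * τ + a' * τ') / (a + a'), fun t => ?_⟩
  unfold tg
  rw [← Real.exp_add, ← Real.exp_add]
  congr 1
  field_simp
  ring

lemma gs_mul {n : ℕ} {a a' : ℝ} (ha : 0 < a) (ha' : 0 < a') (y y' : Euc n) :
    ∃ (c : ℝ) (y₂ : Euc n), ∀ x, gs a y x * gs a' y' x = c * gs (a + a') y₂ x := by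
  refine ⟨Real.exp (-(a * ‖y‖ ^ 2 + a' * ‖y'‖ ^ 2) +
    (a + a') * ‖(a + a')⁻¹ • (a • y + a' • y')‖ ^ 2), (a + a')⁻¹ • (a • y + a' • y'), fun x => ?_⟩
  have hne : a + a' ≠ 0 := by positivity
  have h1 : (a + a') * inner ℝ x ((a + a')⁻¹ • (a • y + a' • y')) =
      a * inner ℝ x y + a' * inner ℝ x y' := by
    rw [inner_smul_right, inner_add_right, inner_smul_right, inner_smul_right,
      mul_inv_cancel_left₀ hne]
  unfold gs
  rw [← Real.exp_add, ← Real.exp_add]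
  congr 1
  rw [norm_sub_sq_real, norm_sub_sq_real, norm_sub_sq_real]
  linear_combination (-2) * h1

/-- set of space-time Gaussians, plus the constant one -/
def GSet (d : ℕ) : Set (BoundedContinuousFunction (ℝ × Euc (d+1)) ℝ) :=
  {f | f = 1 ∨ ∃ (c a b τ : ℝ) (y : Euc (d+1)), 0 < a ∧ 0 < b ∧
    ∀ q, f q = c * (tg a τ q.1 * gs b y q.2)}

lemma GSet_mul {d : ℕ} {f g : BoundedContinuousFunction (ℝ × Euc (d+1)) ℝ}
    (hf : f ∈ GSet d) (hg : g ∈ GSet d) : f * g ∈ GSet d := by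
  rcases hf with rfl | ⟨c, a, b, τ, y, ha, hb, hf⟩
  · simpa using hg
  rcases hg with rfl | ⟨c', a', b', τ', y', ha', hb', hg⟩
  · rw [mul_one]; exact Or.inr ⟨c, a, b, τ, y, ha, hb, hf⟩
  obtain ⟨c1, τ1, h1⟩ := tg_mul ha ha' τ τ'
  obtain ⟨c2, y2, h2⟩ := gs_mul hb hb' y y'
  refine Or.inr ⟨c * c' * c1 * c2, a + a', b + b', τ1, y2, by positivity, by positivity, fun q => ?_⟩
  rw [BoundedContinuousFunction.mul_apply, hf, hg]
  linear_combination c * c' * gs b y q.2 * gs b' y' q.2 * h1 q.1 +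
    c * c' * c1 * tg (a + a') τ1 q.1 * h2 q.2

/-- star subalgebra generated by the Gaussians -/
noncomputable def GAlg (d : ℕ) : StarSubalgebra ℝ (BoundedContinuousFunction (ℝ × Euc (d+1)) ℝ) :=
  { Algebra.adjoin ℝ (GSet d) with
    star_mem' := by
      intro a ha
      have : star a = a := by ext; simp
      rw [this]; exact ha }

lemma mem_GAlg {d : ℕ} {f : BoundedContinuousFunction (ℝ × Euc (d+1)) ℝ} :
    f ∈ GAlg d ↔ f ∈ Submodule.span ℝ (GSet d) := by
  have h1 : f ∈ GAlg d ↔ f ∈ Subalgebra.toSubmodule (Algebra.adjoin ℝ (GSet d)) := Iff.rfl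
  rw [h1, Algebra.adjoin_eq_span]
  have : (Submonoid.closure (GSet d) : Set _) = GSet d := by
    apply Subset.antisymm
    · intro x hx
      refine Submonoid.closure_induction (motive := fun x _ => x ∈ GSet d) (fun x hx => hx) (Or.inl rfl)
        (fun x y _ _ hx hy => GSet_mul hx hy) hx
    · exact Submonoid.subset_closure
  rw [this]

lemma GAlg_separates (d : ℕ) :
    ((GAlg d).map (BoundedContinuousFunction.toContinuousMapStarₐ ℝ)).SeparatesPoints := by
  intro p q hpq
  have hc : Continuous (fun r : ℝ × Euc (d+1) => tg 1 p.1 r.1 * gs 1 p.2 r.2) := by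
    have h1 := (tg_smooth 1 p.1).continuous
    have h2 := (gs_smooth 1 p.2).continuous
    fun_prop
  have hgs : ∀ x, gs 1 p.2 x ≤ 1 := fun x => Real.exp_le_one_iff.2 (by nlinarith [sq_nonneg ‖x - p.2‖])
  let g : BoundedContinuousFunction (ℝ × Euc (d+1)) ℝ :=
    BoundedContinuousFunction.ofNormedAddCommGroup _ hc 1 (fun r => by
      rw [Real.norm_eq_abs, abs_of_pos (mul_pos (tg_pos _ _ _) (gs_pos _ _ _))]
      exact mul_le_one₀ (tg_le_one one_pos _ _) (gs_pos _ _ _).le (hgs _))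
  have hg : g ∈ GAlg d := by
    rw [mem_GAlg]
    apply Submodule.subset_span
    exact Or.inr ⟨1, 1, 1, p.1, p.2, one_pos, one_pos, fun q => by simp [g]⟩
  refine ⟨g, ⟨BoundedContinuousFunction.toContinuousMapStarₐ ℝ g, ⟨g, hg, rfl⟩, rfl⟩, ?_⟩
  intro heq
  apply hpq
  have heq' : tg 1 p.1 p.1 * gs 1 p.2 p.2 = tg 1 p.1 q.1 * gs 1 p.2 q.2 := heq
  have e1 : tg 1 p.1 p.1 * gs 1 p.2 p.2 = 1 := by simp [tg, gs]
  rw [e1] at heq'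
  unfold tg gs at heq'
  rw [← Real.exp_add] at heq'
  have h3 := (Real.exp_eq_one_iff _).1 heq'.symm
  have h4 : (q.1 - p.1) ^ 2 = 0 := by nlinarith [sq_nonneg (q.1 - p.1), sq_nonneg ‖q.2 - p.2‖]
  have h5 : ‖q.2 - p.2‖ ^ 2 = 0 := by nlinarith [sq_nonneg (q.1 - p.1), sq_nonneg ‖q.2 - p.2‖]
  have h6 : q.1 - p.1 = 0 := by simpa using h4
  have h7 : q.2 - p.2 = 0 := by simpa using h5
  exact Prod.ext (sub_eq_zero.1 h6).symm (sub_eq_zero.1 h7).symm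

/-- weight -/
noncomputable def wt {d : ℕ} (q : ℝ × Euc (d+1)) : ℝ := tg 1 0 q.1 * gs 1 0 q.2

/-- reflection in space-time -/
noncomputable def strefl {d : ℕ} (q : ℝ × Euc (d+1)) : ℝ × Euc (d+1) := (q.1, hrefl q.2)

lemma continuous_strefl {d : ℕ} : Continuous (strefl (d := d)) := by
  have := continuous_hrefl (d := d)
  unfold strefl; fun_prop

lemma test_zero {d : ℕ} {T : ℝ} (hT : 0 < T) {u : ℝ → Euc (d+1) → ℝ}
    (humeas : Measurable (Function.uncurry u)) {M : ℝ} (hM : ∀ t x, |u t x| ≤ M)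
    (h : WeakHyp d T u) {g : BoundedContinuousFunction (ℝ × Euc (d+1)) ℝ} (hg : g ∈ GSet d) :
    ∫ q, u q.1 q.2 * wt q * g q ∂(stm d T) = ∫ q, u q.1 q.2 * wt q * g (strefl q) ∂(stm d T) := by
  rcases hg with rfl | ⟨c, a, b, τ, y, ha, hb, hf⟩
  · simp
  obtain ⟨c1, τ1, h1⟩ := tg_mul one_pos ha 0 τ
  obtain ⟨c2, y2, h2⟩ := gs_mul (n := d+1) one_pos hb 0 y
  have h0 : hrefl (0 : Euc (d+1)) = 0 := by simp [hrefl]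
  have key := G_zero hT humeas hM h (a := 1 + a) (b := 1 + b) (by positivity) (by positivity) τ1 y2
  have e1 : ∀ q : ℝ × Euc (d+1), u q.1 q.2 * wt q * g q =
      c * c1 * c2 * (u q.1 q.2 * (tg (1 + a) τ1 q.1 * gs (1 + b) y2 q.2)) := by
    intro q
    rw [hf, wt]
    linear_combination u q.1 q.2 * c * gs 1 0 q.2 * gs b y q.2 * h1 q.1 +
      u q.1 q.2 * c * c1 * tg (1 + a) τ1 q.1 * h2 q.2
  have e2 : ∀ q : ℝ × Euc (d+1), u q.1 q.2 * wt q * g (strefl q) =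
      c * c1 * c2 * (u q.1 q.2 * (tg (1 + a) τ1 q.1 * gs (1 + b) (hrefl y2) q.2)) := by
    intro q
    have e3 : gs 1 0 q.2 = gs 1 0 (hrefl q.2) := by rw [← gs_hrefl, h0]
    rw [hf, wt, strefl, e3, gs_hrefl]
    linear_combination u q.1 q.2 * c * gs 1 0 (hrefl q.2) * gs b y (hrefl q.2) * h1 q.1 +
      u q.1 q.2 * c * c1 * tg (1 + a) τ1 q.1 * h2 (hrefl q.2)
  simp_rw [e1, e2]
  rw [integral_const_mul, integral_const_mul, key]

lemma wt_pos {d : ℕ} (q : ℝ × Euc (d+1)) : 0 < wt q := mul_pos (tg_pos _ _ _) (gs_pos _ _ _)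

lemma main_aux {d : ℕ} {T : ℝ} (hT : 0 < T) {u : ℝ → Euc (d+1) → ℝ}
    (humeas : Measurable (Function.uncurry u)) {M : ℝ} (hM : ∀ t x, |u t x| ≤ M)
    (h : WeakHyp d T u) : ∀ᵐ q ∂(stm d T), u q.1 q.2 = 0 := by
  set μ := stm d T with hμ
  have hwc : Continuous (wt (d := d)) := by
    have h1 := (tg_smooth 1 0).continuous
    have h2 := (gs_smooth 1 (0 : Euc (d+1))).continuous
    unfold wt; fun_prop
  set v : ℝ × Euc (d+1) → ℝ := fun q => u q.1 q.2 * wt q with hv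
  have hvm : Measurable v := Measurable.mul humeas hwc.measurable
  have hvi : Integrable v μ := by
    have h1 : Integrable (fun q : ℝ × Euc (d+1) => gs 1 0 q.2) μ :=
      ((gs_integrable one_pos _).restrict).comp_snd _
    refine Integrable.mono' (h1.const_mul M) hvm.aestronglyMeasurable (ae_of_all _ fun q => ?_)
    rw [Real.norm_eq_abs, hv, abs_mul, abs_of_pos (wt_pos q)]
    refine mul_le_mul (hM _ _) ?_ (wt_pos q).le ((abs_nonneg _).trans (hM 0 0))
    exact mul_le_of_le_one_left (gs_pos _ _ _).le (tg_le_one one_pos _ _)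
  set f1 : ℝ × Euc (d+1) → ℝ≥0∞ := fun q => ENNReal.ofReal (v q) with hf1
  set f2 : ℝ × Euc (d+1) → ℝ≥0∞ := fun q => ENNReal.ofReal (-v q) with hf2
  have hf1m : Measurable f1 := hvm.ennreal_ofReal
  have hf2m : Measurable f2 := hvm.neg.ennreal_ofReal
  have hf1t : ∫⁻ q, f1 q ∂μ ≠ ∞ := (Integrable.lintegral_lt_top hvi).ne
  have hf2t : ∫⁻ q, f2 q ∂μ ≠ ∞ := (Integrable.lintegral_lt_top hvi.neg).ne
  set ν1 := μ.withDensity f1 with hν1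
  set ν2 := μ.withDensity f2 with hν2
  haveI : IsFiniteMeasure ν1 := isFiniteMeasure_withDensity hf1t
  haveI : IsFiniteMeasure ν2 := isFiniteMeasure_withDensity hf2t
  have hρ : Measurable (strefl (d := d)) := continuous_strefl.measurable
  have hdiff : ∀ g : BoundedContinuousFunction (ℝ × Euc (d+1)) ℝ,
      ∫ q, g q ∂ν1 - ∫ q, g q ∂ν2 = ∫ q, v q * g q ∂μ := by
    intro g
    have i1 := g.integrable ν1
    have i2 := g.integrable ν2
    rw [hν1, integrable_withDensity_iff_integrable_smul' hf1m (ae_of_all _ fun _ => ENNReal.ofReal_lt_top)] at i1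
    rw [hν2, integrable_withDensity_iff_integrable_smul' hf2m (ae_of_all _ fun _ => ENNReal.ofReal_lt_top)] at i2
    rw [hν1, hν2, integral_withDensity_eq_integral_toReal_smul hf1m (ae_of_all _ fun _ => ENNReal.ofReal_lt_top),
      integral_withDensity_eq_integral_toReal_smul hf2m (ae_of_all _ fun _ => ENNReal.ofReal_lt_top),
      ← integral_sub i1 i2]
    congr 1
    funext q
    rw [← sub_smul, smul_eq_mul]
    congr 1
    simp only [hf1, hf2]
    rw [ENNReal.toReal_ofReal', ENNReal.toReal_ofReal']
    exact max_zero_sub_eq_self (v q)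
  have hPP : ν1 + ν2.map strefl = ν2 + ν1.map strefl := by
    apply ext_of_forall_mem_subalgebra_integral_eq_of_polish (𝕜 := ℝ) (GAlg_separates d)
    intro g hg
    rw [mem_GAlg] at hg
    refine Submodule.span_induction (p := fun (g : BoundedContinuousFunction (ℝ × Euc (d+1)) ℝ) _ =>
      ∫ x, g x ∂(ν1 + ν2.map strefl) = ∫ x, g x ∂(ν2 + ν1.map strefl)) ?_ ?_ ?_ ?_ hg
    · intro g hg
      rw [integral_add_measure (g.integrable _) (g.integrable _),
        integral_add_measure (g.integrable _) (g.integrable _),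
        integral_map hρ.aemeasurable g.continuous.aestronglyMeasurable,
        integral_map hρ.aemeasurable g.continuous.aestronglyMeasurable]
      have k1 := hdiff g
      have k2 := hdiff (g.compContinuous ⟨strefl, continuous_strefl⟩)
      have k3 := test_zero hT humeas hM h hg
      simp only [BoundedContinuousFunction.compContinuous_apply, ContinuousMap.coe_mk] at k2
      linarith
    · simp
    · intro f g _ _ hf hg
      simp only [BoundedContinuousFunction.coe_add, Pi.add_apply]
      rw [integral_add (f.integrable _) (g.integrable _), integral_add (f.integrable _) (g.integrable _), hf, hg]
    · intro c f _ hf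
      simp only [BoundedContinuousFunction.coe_smul]
      rw [integral_smul, integral_smul, hf]
  set Ω : Set (ℝ × Euc (d+1)) := {q | 0 < q.2 (Fin.last d)} with hΩ
  have hΩm : MeasurableSet Ω := by
    apply IsOpen.measurableSet
    exact isOpen_lt continuous_const (by fun_prop)
  have hae : ∀ᵐ q ∂μ, q ∈ Ω := by
    rw [hμ, stm, Measure.prod_restrict]
    filter_upwards [ae_restrict_mem (measurableSet_Ioo.prod (isOpen_halfSpace d).measurableSet)] with q hq
      using hq.2
  have hac : ∀ (f : ℝ × Euc (d+1) → ℝ≥0∞), ∀ᵐ q ∂(μ.withDensity f), q ∈ Ω := fun f =>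
    (withDensity_absolutelyContinuous μ f).ae_le hae
  have hz : ∀ (f : ℝ × Euc (d+1) → ℝ≥0∞) (A : Set (ℝ × Euc (d+1))), MeasurableSet A →
      ((μ.withDensity f).map strefl) (A ∩ Ω) = 0 := by
    intro f A hA
    rw [Measure.map_apply hρ (hA.inter hΩm)]
    refine measure_mono_null ?_ (hac f)
    intro q hq hq2
    have h1 : 0 < hrefl q.2 (Fin.last d) := hq.2
    have h2 : 0 < q.2 (Fin.last d) := hq2
    rw [hrefl_last] at h1
    linarith
  have hνν : ν1 = ν2 := by
    ext A hA
    have e1 : ν1 A = ν1 (A ∩ Ω) := by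
      apply measure_congr
      filter_upwards [hac f1] with q hq
      exact propext ⟨fun hh => ⟨hh, hq⟩, fun hh => hh.1⟩
    have e2 : ν2 A = ν2 (A ∩ Ω) := by
      apply measure_congr
      filter_upwards [hac f2] with q hq
      exact propext ⟨fun hh => ⟨hh, hq⟩, fun hh => hh.1⟩
    have := congrArg (fun m => m (A ∩ Ω)) hPP
    simp only [Measure.add_apply] at this
    rw [hν1, hν2, hz _ _ hA, hz _ _ hA, add_zero, add_zero] at this
    rw [e1, e2]; exact this
  have hfin := (withDensity_eq_iff hf1m.aemeasurable hf2m.aemeasurable hf1t).1 hνν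
  filter_upwards [hfin] with q hq
  have hv0 : v q = 0 := by
    simp only [hf1, hf2] at hq
    rcases le_total (v q) 0 with h0 | h0
    · rw [ENNReal.ofReal_of_nonpos h0] at hq
      have := ENNReal.ofReal_eq_zero.1 hq.symm
      linarith
    · rw [ENNReal.ofReal_of_nonpos (neg_nonpos.2 h0)] at hq
      have := ENNReal.ofReal_eq_zero.1 hq
      linarith
  exact (mul_eq_zero.1 hv0).resolve_right (wt_pos q).ne'

end HalfSpaceAux

/-- Uniqueness of weak solutions of the heat equation on the
half space `Ω = ℝ^{d+1}_+`: if a bounded measurable `u` satisfies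
`∫₀^T ∫_Ω u (∂ₜφ + Δφ) dx dt = 0` for every test function
`φ ∈ C([0,T]; W^{1,1}₀(Ω) ∩ W^{2,1}(Ω) ∩ C(Ω)) ∩ C¹([0,T]; L¹(Ω))`
with `|∇φ(x)| ≤ C(1+|x|²)^{-D/2}` (`D` the ambient dimension), then `u = 0`
almost everywhere in `(0,T) × Ω`. -/
theorem halfspace_weak_uniqueness
    (d : ℕ) (T : ℝ) (hT : 0 < T)
    (u : ℝ → Euc (d+1) → ℝ)
    (humeas : Measurable (Function.uncurry u))
    (hubdd : ∃ M : ℝ, ∀ t x, |u t x| ≤ M)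
    (h : ∀ φ : ℝ → Euc (d+1) → ℝ,
      (∀ t ∈ Set.Icc 0 T, ContDiffOn ℝ 2 (φ t) (halfSpace d)) →
      (∀ t ∈ Set.Icc 0 T, MemW (halfSpace d) 1 2 (φ t)) →
      (∀ t ∈ Set.Icc 0 T, MemW10 (halfSpace d) 1 (φ t)) →
      (∀ t ∈ Set.Icc 0 T, ContinuousOn (φ t) (halfSpace d)) →
      (∀ x ∈ halfSpace d, ∀ t ∈ Set.Icc 0 T,
        DifferentiableAt ℝ (fun s => φ s x) t) →
      (∀ t ∈ Set.Icc 0 T,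
        MemLp (fun x => deriv (fun s => φ s x) t) 1
          (volume.restrict (halfSpace d))) →
      (∀ t₀ ∈ Set.Icc 0 T,
        Tendsto (fun s =>
            eLpNorm (fun x => φ s x - φ t₀ x) 1 (volume.restrict (halfSpace d)))
          (𝓝[Set.Icc 0 T] t₀) (𝓝 0)) →
      (∀ t₀ ∈ Set.Icc 0 T,
        Tendsto (fun s =>
            eLpNorm (fun x => deriv (fun r => φ r x) s - deriv (fun r => φ r x) t₀)
              1 (volume.restrict (halfSpace d)))
          (𝓝[Set.Icc 0 T] t₀) (𝓝 0)) →
      (∃ Cφ : ℝ, ∀ t ∈ Set.Icc 0 T, ∀ x ∈ halfSpace d,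
        ‖fderiv ℝ (φ t) x‖ ≤ Cφ * (1 + ‖x‖ ^ 2) ^ (-((d : ℝ) + 1) / 2)) →
      ∫ s in Set.Ioo 0 T,
        ∫ x in halfSpace d,
          u s x * (deriv (fun r => φ r x) s + lap (φ s) x) = 0) :
    ∀ᵐ q ∂((volume.restrict (Set.Ioo (0:ℝ) T)).prod
        (volume.restrict (halfSpace d))), u q.1 q.2 = 0 := by
  obtain ⟨M, hM⟩ := hubdd
  exact main_aux hT humeas hM h
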